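/- Performance difference lemma across policies: for any two policies π, π' ∈ Π and any transition kernel p, J_ρ(π,p) − J_ρ(π',p) = (1/(1−γ)) Σ_{s,a} d^{π,p}_ρ(s) · π_{sa} · (q^{π',p}_{sa} − v^{π',p}_s). -/

import Mathlib

open scoped BigOperators

noncomputable section

namespace RMDPStmt

variable {S A : ℕ}

/-- `p` is a transition kernel: each `p s a` lies in the probability simplex `Δ^S`. -/
def IsKernel (p : Fin S → Fin A → Fin S → ℝ) : Prop :=
  ∀ s a, p s a ∈ stdSimplex ℝ (Fin S)

/-- `π` is a stationary randomized policy: each `π s` lies in the simplex `Δ^A`. -/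
def IsPolicy (π : Fin S → Fin A → ℝ) : Prop :=
  ∀ s, π s ∈ stdSimplex ℝ (Fin A)

/-- The state-to-state matrix `P^π`. -/
def Pmat (π : Fin S → Fin A → ℝ) (p : Fin S → Fin A → Fin S → ℝ) :
    Matrix (Fin S) (Fin S) ℝ :=
  Matrix.of fun s s' => ∑ a, π s a * p s a s'

/-- The expected one-step cost vector `c^π`. -/
def cvec (c : Fin S → Fin A → Fin S → ℝ) (π : Fin S → Fin A → ℝ)
    (p : Fin S → Fin A → Fin S → ℝ) : Fin S → ℝ :=
  fun s => ∑ a, π s a * ∑ s', p s a s' * c s a s'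

/-- Value function `v^{π,p}` as a discounted series. -/
def value (γ : ℝ) (c : Fin S → Fin A → Fin S → ℝ) (π : Fin S → Fin A → ℝ)
    (p : Fin S → Fin A → Fin S → ℝ) : Fin S → ℝ :=
  fun s => ∑' t : ℕ, γ ^ t * ((Pmat π p ^ t).mulVec (cvec c π p)) s

/-- The return `J_ρ(π,p)`. -/
def J (γ : ℝ) (c : Fin S → Fin A → Fin S → ℝ) (ρ : Fin S → ℝ)
    (π : Fin S → Fin A → ℝ) (p : Fin S → Fin A → Fin S → ℝ) : ℝ :=
  ∑ s, ρ s * value γ c π p s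

/-- The action-value function `q^{π,p}`. -/
def qval (γ : ℝ) (c : Fin S → Fin A → Fin S → ℝ) (π : Fin S → Fin A → ℝ)
    (p : Fin S → Fin A → Fin S → ℝ) : Fin S → Fin A → ℝ :=
  fun s a => ∑ s', p s a s' * (c s a s' + γ * value γ c π p s')

/-- The discounted state occupancy measure `d^{π,p}_ρ`. -/
def occ (γ : ℝ) (ρ : Fin S → ℝ) (π : Fin S → Fin A → ℝ)
    (p : Fin S → Fin A → Fin S → ℝ) : Fin S → ℝ :=
  fun s' => (1 - γ) * ∑' t : ℕ, γ ^ t * ∑ s, ρ s * (Pmat π p ^ t) s s'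

/-- Bregman divergence generated by `h`. -/
def breg {E : Type*} [NormedAddCommGroup E] [NormedSpace ℝ E]
    (h : E → ℝ) (x y : E) : ℝ :=
  h x - h y - fderiv ℝ h y (x - y)

/-- Weighted Bregman divergence `B_μ`. -/
def bregW {E : Type*} [NormedAddCommGroup E] [NormedSpace ℝ E]
    (μ : Fin S → ℝ) (h : E → ℝ) (x y : Fin S → E) : ℝ :=
  ∑ s, μ s * breg h (x s) (y s)

/-- Inner product of two action-indexed vectors. -/
def dotA (u v : Fin A → ℝ) : ℝ := ∑ a, u a * v a

/-- Inner product of two action-by-state arrays. -/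
def dotAS (u v : Fin A → Fin S → ℝ) : ℝ := ∑ a, ∑ s', u a s' * v a s'

/-- The robust objective `Φ(π) = sup_{p ∈ Amb} J_ρ(π,p)`. -/
def Phi (γ : ℝ) (c : Fin S → Fin A → Fin S → ℝ) (ρ : Fin S → ℝ)
    (Amb : Set (Fin S → Fin A → Fin S → ℝ)) (π : Fin S → Fin A → ℝ) : ℝ :=
  sSup ((fun p => J γ c ρ π p) '' Amb)

/-- The distribution mismatch coefficient
`M = sup_{π ∈ Π, p ∈ Amb} max_s d^{π,p}_ρ(s)/ρ_s`. -/
def mismatch (γ : ℝ) (ρ : Fin S → ℝ)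
    (Amb : Set (Fin S → Fin A → Fin S → ℝ)) : ℝ :=
  sSup {x : ℝ | ∃ (π : Fin S → Fin A → ℝ) (p : Fin S → Fin A → Fin S → ℝ),
    IsPolicy π ∧ p ∈ Amb ∧ ∃ s, x = occ γ ρ π p s / ρ s}


/-- The transition matrix of a policy is row stochastic. -/
theorem Pmat_mem_rowStochastic {π : Fin S → Fin A → ℝ} {p : Fin S → Fin A → Fin S → ℝ}
    (hπ : IsPolicy π) (hp : IsKernel p) :
    Pmat π p ∈ Matrix.rowStochastic ℝ (Fin S) := by
  rw [Matrix.mem_rowStochastic_iff_sum]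
  simp only [Pmat, Matrix.of_apply]
  refine ⟨fun s s' => Finset.sum_nonneg fun a _ => mul_nonneg ((hπ s).1 a) ((hp s a).1 s'),
    fun s => ?_⟩
  rw [Finset.sum_comm]
  simp_rw [← Finset.mul_sum, (hp s _).2, mul_one]
  exact (hπ s).2

/-- The entries of the Neumann series of a row stochastic matrix are summable. -/
theorem summable_pow_mul_rowStochastic {γ : ℝ} (hγ : γ ∈ Set.Ioo (0 : ℝ) 1)
    {M : Matrix (Fin S) (Fin S) ℝ} (hM : M ∈ Matrix.rowStochastic ℝ (Fin S)) (s s' : Fin S) :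
    Summable fun t : ℕ => γ ^ t * (M ^ t) s s' := by
  have hpow (t : ℕ) : M ^ t ∈ Matrix.rowStochastic ℝ (Fin S) := pow_mem hM t
  refine Summable.of_nonneg_of_le (fun t => ?_) (fun t => ?_)
    (summable_geometric_of_lt_one hγ.1.le hγ.2)
  · exact mul_nonneg (pow_nonneg hγ.1.le t) (Matrix.nonneg_of_mem_rowStochastic (hpow t))
  · exact mul_le_of_le_one_right (pow_nonneg hγ.1.le t)
      (Matrix.le_one_of_mem_rowStochastic (hpow t))

/-- The discounted resolvent `∑ₜ γ^t M^t`, defined entrywise. -/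
def resolvent (γ : ℝ) (M : Matrix (Fin S) (Fin S) ℝ) : Matrix (Fin S) (Fin S) ℝ :=
  Matrix.of fun s s' => ∑' t : ℕ, γ ^ t * (M ^ t) s s'

theorem resolvent_eq_one_add {γ : ℝ} (hγ : γ ∈ Set.Ioo (0 : ℝ) 1)
    {M : Matrix (Fin S) (Fin S) ℝ} (hM : M ∈ Matrix.rowStochastic ℝ (Fin S)) :
    resolvent γ M = 1 + γ • (resolvent γ M * M) := by
  ext s s'
  simp only [resolvent, Matrix.of_apply, Matrix.add_apply, Matrix.smul_apply, Matrix.mul_apply,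
    smul_eq_mul]
  rw [(summable_pow_mul_rowStochastic hγ hM s s').tsum_eq_zero_add]
  simp_rw [← tsum_mul_right]
  rw [← Summable.tsum_finsetSum
    fun r _ => (summable_pow_mul_rowStochastic hγ hM s r).mul_right (M r s'), ← tsum_mul_left]
  simp only [pow_zero, one_mul]
  congr 1
  refine tsum_congr fun t => ?_
  rw [pow_succ M, Matrix.mul_apply, Finset.mul_sum, Finset.mul_sum]
  exact Finset.sum_congr rfl fun r _ => by ring

theorem value_eq_resolvent_mulVec {γ : ℝ} (hγ : γ ∈ Set.Ioo (0 : ℝ) 1)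
    (c : Fin S → Fin A → Fin S → ℝ) {π : Fin S → Fin A → ℝ} {p : Fin S → Fin A → Fin S → ℝ}
    (hπ : IsPolicy π) (hp : IsKernel p) :
    value γ c π p = (resolvent γ (Pmat π p)).mulVec (cvec c π p) := by
  have hsum := summable_pow_mul_rowStochastic hγ (Pmat_mem_rowStochastic hπ hp)
  funext s
  simp only [value, resolvent, Matrix.mulVec, dotProduct, Matrix.of_apply]
  simp_rw [← tsum_mul_right]
  rw [← Summable.tsum_finsetSum fun r _ => (hsum s r).mul_right _]
  refine tsum_congr fun t => ?_
  rw [Finset.mul_sum]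
  exact Finset.sum_congr rfl fun r _ => by ring

theorem occ_eq_vecMul_resolvent {γ : ℝ} (hγ : γ ∈ Set.Ioo (0 : ℝ) 1) (ρ : Fin S → ℝ)
    {π : Fin S → Fin A → ℝ} {p : Fin S → Fin A → Fin S → ℝ}
    (hπ : IsPolicy π) (hp : IsKernel p) :
    occ γ ρ π p = (1 - γ) • Matrix.vecMul ρ (resolvent γ (Pmat π p)) := by
  have hsum := summable_pow_mul_rowStochastic hγ (Pmat_mem_rowStochastic hπ hp)
  funext s'
  simp only [occ, resolvent, Matrix.vecMul, dotProduct, Matrix.of_apply, Pi.smul_apply,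
    smul_eq_mul]
  simp_rw [← tsum_mul_left (a := ρ _)]
  rw [← Summable.tsum_finsetSum fun r _ => (hsum r s').mul_left _]
  congr 1
  refine tsum_congr fun t => ?_
  rw [Finset.mul_sum]
  exact Finset.sum_congr rfl fun r _ => by ring

/-- The policy average of the advantage function of `π'` is a one-step Bellman residual. -/
theorem sum_mul_qval_sub_value (γ : ℝ) (c : Fin S → Fin A → Fin S → ℝ)
    {π : Fin S → Fin A → ℝ} (π' : Fin S → Fin A → ℝ) (p : Fin S → Fin A → Fin S → ℝ)
    (hπ : IsPolicy π) (s : Fin S) :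
    ∑ a, π s a * (qval γ c π' p s a - value γ c π' p s) =
      (cvec c π p + γ • (Pmat π p).mulVec (value γ c π' p) - value γ c π' p) s := by
  simp only [mul_sub, Finset.sum_sub_distrib, Pi.sub_apply, Pi.add_apply, Pi.smul_apply,
    smul_eq_mul]
  rw [← Finset.sum_mul, (hπ s).2, one_mul]
  congr 1
  simp only [qval, cvec, Pmat, Matrix.mulVec, dotProduct, Matrix.of_apply, mul_add,
    Finset.sum_add_distrib, Finset.mul_sum, Finset.sum_mul]
  congr 1
  rw [Finset.sum_comm]
  exact Finset.sum_congr rfl fun s' _ => Finset.sum_congr rfl fun a _ => by ring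

/-- Performance difference lemma across policies. -/
theorem performance_difference_across_policies
    {S A : ℕ} (hS : 0 < S) (hA : 0 < A)
    (γ : ℝ) (hγ : γ ∈ Set.Ioo (0 : ℝ) 1)
    (c : Fin S → Fin A → Fin S → ℝ)
    (hc : ∀ s a s', c s a s' ∈ Set.Icc (0 : ℝ) 1)
    (ρ : Fin S → ℝ) (hρ : ρ ∈ stdSimplex ℝ (Fin S))
    (π π' : Fin S → Fin A → ℝ) (hπ : IsPolicy π) (hπ' : IsPolicy π')
    (p : Fin S → Fin A → Fin S → ℝ) (hp : IsKernel p) :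
    J γ c ρ π p - J γ c ρ π' p =
      (1 / (1 - γ)) * ∑ s, ∑ a, occ γ ρ π p s * π s a *
        (qval γ c π' p s a - value γ c π' p s) := by
  have hγ1 : 1 - γ ≠ 0 := (sub_pos.2 hγ.2).ne'
  set R := resolvent γ (Pmat π p) with hR
  set w := value γ c π' p with hw
  have hres : R.mulVec (γ • (Pmat π p).mulVec w) = R.mulVec w - w := by
    have h := congrArg (fun N => Matrix.mulVec N w)
      (resolvent_eq_one_add hγ (Pmat_mem_rowStochastic hπ hp))
    simp only [← hR, Matrix.add_mulVec, Matrix.one_mulVec, Matrix.smul_mulVec] at h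
    rw [Matrix.mulVec_smul, Matrix.mulVec_mulVec, eq_sub_iff_add_eq, add_comm]
    exact h.symm
  have hadv : ∑ s, ∑ a, occ γ ρ π p s * π s a * (qval γ c π' p s a - w s) =
      (1 - γ) * (ρ ⬝ᵥ (value γ c π p - w)) := by
    simp_rw [mul_assoc, ← Finset.mul_sum, hw, sum_mul_qval_sub_value γ c π' p hπ, ← hw]
    change occ γ ρ π p ⬝ᵥ _ = _
    rw [occ_eq_vecMul_resolvent hγ ρ hπ hp, smul_dotProduct, ← Matrix.dotProduct_mulVec,
      Matrix.mulVec_sub, Matrix.mulVec_add, ← hR, hres, value_eq_resolvent_mulVec hγ c hπ hp,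
      smul_eq_mul]
    congr 2
    abel
  rw [hadv, ← mul_assoc, one_div_mul_cancel hγ1, one_mul, dotProduct_sub]
  rfl

end RMDPStmt
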